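/- arXiv:2412.02091 — 7 statements merged into one kernel-verified Lean document; each statement's English description precedes it below -/
import Mathlib

section
/- Every Vickrey-Clarke-Groves mechanism is incentive compatible: if (f, p_1, …, p_k) is a mechanism such that f(v_1,…,v_k) ∈ argmax_{a∈Alt} Σ_i v_i(a) and there exist functions h_i of the other agents' valuations with p_i(v_1,…,v_k) = h_i(v_{−i}) − Σ_{j≠i} v_j(f(v_1,…,v_k)), then for every agent i, every true valuation v_i, every alternative report v_i′, and every profile v_{−i} of the other agents' valuations, v_i(f(v_i, v_{−i})) − p_i(v_i, v_{−i}) ≥ v_i(f(v_i′, v_{−i})) − p_i(v_i′, v_{−i}). -/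
/-- Every Vickrey-Clarke-Groves mechanism is incentive compatible. -/
theorem vcg_incentive_compatible
    {k : ℕ} {Alt : Type*} [Fintype Alt] [Nonempty Alt]
    (f : (Fin k → Alt → ℝ) → Alt)
    (p : Fin k → (Fin k → Alt → ℝ) → ℝ)
    -- `f` maximises social welfare
    (hf : ∀ (v : Fin k → Alt → ℝ) (a : Alt), ∑ i, v i a ≤ ∑ i, v i (f v))
    -- there exist functions `h i` depending only on the other agents' valuations
    (h : Fin k → (Fin k → Alt → ℝ) → ℝ)
    (hh : ∀ (i : Fin k) (v v' : Fin k → Alt → ℝ),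
      (∀ j, j ≠ i → v j = v' j) → h i v = h i v')
    (hp : ∀ (i : Fin k) (v : Fin k → Alt → ℝ),
      p i v = h i v - ∑ j ∈ Finset.univ.erase i, v j (f v)) :
    -- incentive compatibility: truthful reporting is optimal
    ∀ (i : Fin k) (v : Fin k → Alt → ℝ) (v' : Alt → ℝ),
      v i (f (Function.update v i v')) - p i (Function.update v i v')
        ≤ v i (f v) - p i v := by
  intro i v v'
  have h_eq : h i (Function.update v i v') = h i v :=
    hh i _ _ fun j hj => Function.update_of_ne hj _ _
  have h_others : ∀ a, ∑ j ∈ Finset.univ.erase i, Function.update v i v' j a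
      = ∑ j ∈ Finset.univ.erase i, v j a := fun a =>
    Finset.sum_congr rfl fun j hj => by
      rw [Function.update_of_ne (Finset.ne_of_mem_erase hj)]
  have h_welfare : ∀ a, v i a + ∑ j ∈ Finset.univ.erase i, v j a = ∑ j, v j a := fun a =>
    Finset.add_sum_erase _ (fun j => v j a) (Finset.mem_univ i)
  rw [hp, hp, h_eq, h_others]
  linarith [hf v (f (Function.update v i v')), h_welfare (f v),
    h_welfare (f (Function.update v i v'))]
end

section
/- In the Exponential VCG Mechanism, for any agent i with true valuation v_i : Alt → [0,1], any fixed bids v_{−i} of the other agents, and any bid b_i : Alt → [0,1], the expected utility of agent i satisfies E_{r ∼ M_q^ε(b_i, v_{−i})}[ v_i(r) ] − p_i(b_i, v_{−i}) = −(2/ε) D_KL( M_q^ε(b_i, v_{−i}) ‖ M_q^ε(v_i, v_{−i}) ) + h(v_i, v_{−i}) − h(v_{−i}), where h({v_j}_{j∈S}) = (2/ε) ln( Σ_{r∈Alt} exp( (ε/2) Σ_{j∈S} v_j(r) ) ). -/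
/-- The Exponential DP Mechanism with quality function `q(v,r) = Σ_i v_i(r)`:
probability of alternative `r` under profile `v`. -/
noncomputable def expMech {k : ℕ} {Alt : Type*} [Fintype Alt]
    (ε : ℝ) (v : Fin k → Alt → ℝ) (r : Alt) : ℝ :=
  Real.exp (ε / 2 * ∑ j, v j r) / ∑ a, Real.exp (ε / 2 * ∑ j, v j a)

/-- Shannon entropy of a probability mass function on a finite set. -/
noncomputable def shannonEntropy {Alt : Type*} [Fintype Alt] (p : Alt → ℝ) : ℝ :=
  -∑ r, p r * Real.log (p r)

/-- Kullback-Leibler divergence between two probability mass functions. -/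
noncomputable def klDivergence {Alt : Type*} [Fintype Alt] (p q : Alt → ℝ) : ℝ :=
  ∑ r, p r * Real.log (p r / q r)

/-- The Exponential VCG Mechanism payment charged to agent `i` under profile `v`. -/
noncomputable def expVCGPay {k : ℕ} {Alt : Type*} [Fintype Alt]
    (ε : ℝ) (i : Fin k) (v : Fin k → Alt → ℝ) : ℝ :=
  (∑ r, expMech ε v r * (-(∑ j ∈ Finset.univ.erase i, v j r)))
    - (2 / ε) * shannonEntropy (expMech ε v)
    + (2 / ε) * Real.log (∑ r, Real.exp (ε / 2 * ∑ j ∈ Finset.univ.erase i, v j r))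

theorem sum_exp_welfare_pos {k : ℕ} {Alt : Type*} [Fintype Alt] [Nonempty Alt]
    (ε : ℝ) (v : Fin k → Alt → ℝ) : 0 < ∑ a, Real.exp (ε / 2 * ∑ j, v j a) :=
  Finset.sum_pos (fun _ _ => Real.exp_pos _) Finset.univ_nonempty

theorem expMech_pos {k : ℕ} {Alt : Type*} [Fintype Alt] [Nonempty Alt]
    (ε : ℝ) (v : Fin k → Alt → ℝ) (r : Alt) : 0 < expMech ε v r :=
  div_pos (Real.exp_pos _) (sum_exp_welfare_pos ε v)

theorem sum_expMech {k : ℕ} {Alt : Type*} [Fintype Alt] [Nonempty Alt]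
    (ε : ℝ) (v : Fin k → Alt → ℝ) : ∑ r, expMech ε v r = 1 := by
  simp only [expMech, ← Finset.sum_div]
  exact div_self (sum_exp_welfare_pos ε v).ne'

theorem log_expMech {k : ℕ} {Alt : Type*} [Fintype Alt] [Nonempty Alt]
    (ε : ℝ) (v : Fin k → Alt → ℝ) (r : Alt) :
    Real.log (expMech ε v r)
      = ε / 2 * ∑ j, v j r - Real.log (∑ a, Real.exp (ε / 2 * ∑ j, v j a)) := by
  rw [expMech, Real.log_div (Real.exp_pos _).ne' (sum_exp_welfare_pos ε v).ne', Real.log_exp]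

/-- The divergence of a positive probability mass function from the mechanism is the log-partition
function minus the entropy and the scaled expected welfare. -/
theorem klDivergence_expMech {k : ℕ} {Alt : Type*} [Fintype Alt] [Nonempty Alt]
    (ε : ℝ) (v : Fin k → Alt → ℝ) (p : Alt → ℝ) (hp : ∀ r, 0 < p r) (hp_sum : ∑ r, p r = 1) :
    klDivergence p (expMech ε v)
      = Real.log (∑ a, Real.exp (ε / 2 * ∑ j, v j a)) - shannonEntropy p
        - ε / 2 * ∑ r, p r * ∑ j, v j r := by
  set L := Real.log (∑ a, Real.exp (ε / 2 * ∑ j, v j a)) with hL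
  have hterm (r : Alt) : p r * Real.log (p r / expMech ε v r)
      = p r * L + p r * Real.log (p r) - ε / 2 * (p r * ∑ j, v j r) := by
    rw [Real.log_div (hp r).ne' (expMech_pos ε v r).ne', log_expMech, ← hL]
    ring
  simp only [klDivergence, shannonEntropy, hterm, Finset.sum_sub_distrib, Finset.sum_add_distrib,
    ← Finset.sum_mul, ← Finset.mul_sum, hp_sum]
  ring

/-- the expected-utility identity for the Exponential VCG Mechanism:
E_{r ∼ M(b_i, v_{−i})}[v_i(r)] − p_i(b_i, v_{−i})
  = −(2/ε) D_KL(M(b_i, v_{−i}) ‖ M(v_i, v_{−i})) + h(v_i, v_{−i}) − h(v_{−i}). -/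
theorem exp_vcg_expected_utility_identity
    {k : ℕ} {Alt : Type*} [Fintype Alt] [Nonempty Alt]
    (ε : ℝ) (hε : 0 < ε)
    (v : Fin k → Alt → ℝ) (hv : ∀ j r, v j r ∈ Set.Icc (0:ℝ) 1)
    (i : Fin k) (b : Alt → ℝ) (hb : ∀ r, b r ∈ Set.Icc (0:ℝ) 1) :
    (∑ r, expMech ε (Function.update v i b) r * v i r)
        - expVCGPay ε i (Function.update v i b)
      = -(2 / ε) * klDivergence (expMech ε (Function.update v i b)) (expMech ε v)
        + (2 / ε) * Real.log (∑ r, Real.exp (ε / 2 * ∑ j, v j r))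
        - (2 / ε) * Real.log (∑ r, Real.exp (ε / 2 * ∑ j ∈ Finset.univ.erase i, v j r)) := by
  have herase (r : Alt) : ∑ j ∈ Finset.univ.erase i, Function.update v i b j r
      = ∑ j ∈ Finset.univ.erase i, v j r :=
    Finset.sum_congr rfl fun j hj => by rw [Function.update_of_ne (Finset.ne_of_mem_erase hj)]
  have hwelfare (p : Alt → ℝ) : ∑ r, p r * ∑ j, v j r
      = ∑ r, p r * v i r - ∑ r, p r * -∑ j ∈ Finset.univ.erase i, v j r := by
    rw [← Finset.sum_sub_distrib]
    refine Finset.sum_congr rfl fun r _ => ?_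
    rw [← Finset.add_sum_erase Finset.univ (fun j => v j r) (Finset.mem_univ i)]
    ring
  rw [klDivergence_expMech ε v _ (expMech_pos ε _) (sum_expMech ε _), hwelfare, expVCGPay]
  simp only [herase]
  field_simp
  ring
end

section
/- The Exponential VCG Mechanism is incentive compatible: for any agent i with true valuation v_i : Alt → [0,1] and any fixed bids v_{−i} of the other agents, the expected utility E_{r ∼ M_q^ε(b_i, v_{−i})}[ v_i(r) ] − p_i(b_i, v_{−i}) over bids b_i : Alt → [0,1] is maximised at the truthful bid b_i = v_i. -/
/-- The Gibbs distribution of `f` has total mass one. -/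
theorem sum_exp_div_sum_exp {α : Type*} [Fintype α] [Nonempty α] (f : α → ℝ) :
    ∑ r, Real.exp (f r) / ∑ a, Real.exp (f a) = 1 := by
  have hZ : 0 < ∑ a, Real.exp (f a) :=
    Finset.sum_pos (fun a _ => Real.exp_pos _) Finset.univ_nonempty
  rw [← Finset.sum_div, div_self hZ.ne']

/-- Gibbs variational inequality: free energy is at most the log-partition function. -/
theorem sum_mul_add_shannonEntropy_le {α : Type*} [Fintype α] [Nonempty α] (f p : α → ℝ)
    (hp : ∀ r, 0 < p r) (hsum : ∑ r, p r = 1) :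
    ∑ r, p r * f r + shannonEntropy p ≤ Real.log (∑ r, Real.exp (f r)) := by
  have hZ : 0 < ∑ a, Real.exp (f a) :=
    Finset.sum_pos (fun a _ => Real.exp_pos _) Finset.univ_nonempty
  have key : ∀ r, p r * f r - p r * Real.log (p r) - p r * Real.log (∑ a, Real.exp (f a))
      ≤ Real.exp (f r) / (∑ a, Real.exp (f a)) - p r := fun r => by
    have hpos : 0 < Real.exp (f r) / (∑ a, Real.exp (f a)) / p r :=
      div_pos (div_pos (Real.exp_pos _) hZ) (hp r)
    have h := mul_le_mul_of_nonneg_left (Real.log_le_sub_one_of_pos hpos) (hp r).le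
    rw [Real.log_div (div_pos (Real.exp_pos _) hZ).ne' (hp r).ne',
      Real.log_div (Real.exp_pos _).ne' hZ.ne', Real.log_exp, mul_sub (p r) (_ / _),
      mul_div_cancel₀ _ (hp r).ne'] at h
    linarith
  have h := Finset.sum_le_sum fun r (_ : r ∈ Finset.univ) => key r
  simp only [Finset.sum_sub_distrib, ← Finset.sum_mul, hsum, sum_exp_div_sum_exp] at h
  unfold shannonEntropy
  linarith

/-- The Gibbs distribution attains equality in the Gibbs variational inequality. -/
theorem sum_mul_add_shannonEntropy_gibbs {α : Type*} [Fintype α] [Nonempty α] (f p : α → ℝ)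
    (hp : ∀ r, p r = Real.exp (f r) / ∑ a, Real.exp (f a)) :
    ∑ r, p r * f r + shannonEntropy p = Real.log (∑ r, Real.exp (f r)) := by
  have hZ : 0 < ∑ a, Real.exp (f a) :=
    Finset.sum_pos (fun a _ => Real.exp_pos _) Finset.univ_nonempty
  have hsum : ∑ r, p r = 1 := by simp only [hp, sum_exp_div_sum_exp]
  have hlog : ∀ r, Real.log (p r) = f r - Real.log (∑ a, Real.exp (f a)) := fun r => by
    rw [hp, Real.log_div (Real.exp_pos _).ne' hZ.ne', Real.log_exp]
  simp only [shannonEntropy, hlog, mul_sub, Finset.sum_sub_distrib, ← Finset.sum_mul, hsum]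
  ring

/-- The expected utility of an agent with valuation `u`, as a rescaled free energy minus a term
independent of the agent's own bid. -/
theorem expected_utility_eq {k : ℕ} {Alt : Type*} [Fintype Alt] {ε : ℝ} (hε : ε ≠ 0)
    (i : Fin k) (w : Fin k → Alt → ℝ) (u : Alt → ℝ) :
    (∑ r, expMech ε w r * u r) - expVCGPay ε i w
      = 2 / ε * (∑ r, expMech ε w r * (ε / 2 * (u r + ∑ j ∈ Finset.univ.erase i, w j r))
          + shannonEntropy (expMech ε w))
        - 2 / ε * Real.log (∑ r, Real.exp (ε / 2 * ∑ j ∈ Finset.univ.erase i, w j r)) := by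
  have h : ∑ r, expMech ε w r * (u r + ∑ j ∈ Finset.univ.erase i, w j r)
      = 2 / ε * ∑ r, expMech ε w r * (ε / 2 * (u r + ∑ j ∈ Finset.univ.erase i, w j r)) := by
    rw [Finset.mul_sum]
    refine Finset.sum_congr rfl fun r _ => ?_
    field_simp
  rw [mul_add, ← h]
  simp only [expVCGPay, mul_add, mul_neg, Finset.sum_add_distrib, Finset.sum_neg_distrib]
  ring

/-- The Exponential VCG Mechanism is incentive compatible: the expected
utility of agent `i` over bids `b_i` is maximised at the truthful bid `b_i = v_i`. -/
theorem exp_vcg_incentive_compatible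
    {k : ℕ} {Alt : Type*} [Fintype Alt] [Nonempty Alt]
    (ε : ℝ) (hε : 0 < ε)
    (v : Fin k → Alt → ℝ) (hv : ∀ j r, v j r ∈ Set.Icc (0:ℝ) 1)
    (i : Fin k) (b : Alt → ℝ) (hb : ∀ r, b r ∈ Set.Icc (0:ℝ) 1) :
    (∑ r, expMech ε (Function.update v i b) r * v i r)
        - expVCGPay ε i (Function.update v i b)
      ≤ (∑ r, expMech ε v r * v i r) - expVCGPay ε i v := by
  have hothers : ∀ r, ∑ j ∈ Finset.univ.erase i, Function.update v i b j r
      = ∑ j ∈ Finset.univ.erase i, v j r := fun r =>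
    Finset.sum_congr rfl fun j hj => by rw [Function.update_of_ne (Finset.ne_of_mem_erase hj)]
  have htotal : ∀ r, v i r + ∑ j ∈ Finset.univ.erase i, v j r = ∑ j, v j r := fun r =>
    Finset.add_sum_erase _ (fun j => v j r) (Finset.mem_univ i)
  rw [expected_utility_eq hε.ne', expected_utility_eq hε.ne']
  simp only [hothers, htotal]
  rw [sum_mul_add_shannonEntropy_gibbs (fun r => ε / 2 * ∑ j, v j r) (expMech ε v) fun _ => rfl]
  gcongr
  exact sum_mul_add_shannonEntropy_le (fun r => ε / 2 * ∑ j, v j r) _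
    (fun r => div_pos (Real.exp_pos _)
      (Finset.sum_pos (fun a _ => Real.exp_pos _) Finset.univ_nonempty))
    (sum_exp_div_sum_exp _)
end

section
/- The Exponential VCG Mechanism is individually rational: for any agent i with true valuation v_i : Alt → [0,1] and any bids v_{−i} of the other agents, the truthful expected utility satisfies E_{r ∼ M_q^ε(v_i, v_{−i})}[ v_i(r) ] − p_i(v_i, v_{−i}) = h(v_i, v_{−i}) − h(v_{−i}) ≥ 0, where h({v_j}_{j∈S}) = (2/ε) ln( Σ_{r∈Alt} exp( (ε/2) Σ_{j∈S} v_j(r) ) ); moreover this utility equals zero when v_i is the zero function. -/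
theorem shannonEntropy_expMech {k : ℕ} {Alt : Type*} [Fintype Alt] [Nonempty Alt]
    (ε : ℝ) (v : Fin k → Alt → ℝ) :
    shannonEntropy (expMech ε v)
      = Real.log (∑ a, Real.exp (ε / 2 * ∑ j, v j a))
        - ε / 2 * ∑ r, expMech ε v r * ∑ j, v j r := by
  simp only [shannonEntropy, log_expMech, mul_sub, Finset.sum_sub_distrib]
  rw [← Finset.sum_mul, sum_expMech, Finset.mul_sum]
  simp only [mul_left_comm (ε / 2)]
  ring

theorem expVCG_utility_eq {k : ℕ} {Alt : Type*} [Fintype Alt] [Nonempty Alt]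
    {ε : ℝ} (hε : ε ≠ 0) (v : Fin k → Alt → ℝ) (i : Fin k) :
    (∑ r, expMech ε v r * v i r) - expVCGPay ε i v
      = (2 / ε) * Real.log (∑ r, Real.exp (ε / 2 * ∑ j, v j r))
        - (2 / ε) * Real.log (∑ r, Real.exp (ε / 2 * ∑ j ∈ Finset.univ.erase i, v j r)) := by
  have hsum : ∑ r, expMech ε v r * ∑ j, v j r
      = (∑ r, expMech ε v r * v i r)
        - ∑ r, expMech ε v r * (-(∑ j ∈ Finset.univ.erase i, v j r)) := by
    rw [← Finset.sum_sub_distrib]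
    refine Finset.sum_congr rfl fun r _ => ?_
    rw [← Finset.add_sum_erase Finset.univ (fun j => v j r) (Finset.mem_univ i)]
    ring
  rw [expVCGPay, shannonEntropy_expMech, hsum]
  field_simp
  ring

/-- The Exponential VCG Mechanism is individually rational: the truthful
expected utility equals h(v_i, v_{−i}) − h(v_{−i}) ≥ 0, and it equals zero when v_i is
the zero function. -/
theorem exp_vcg_individually_rational
    {k : ℕ} {Alt : Type*} [Fintype Alt] [Nonempty Alt]
    (ε : ℝ) (hε : 0 < ε)
    (v : Fin k → Alt → ℝ) (hv : ∀ j r, v j r ∈ Set.Icc (0:ℝ) 1)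
    (i : Fin k) :
    ((∑ r, expMech ε v r * v i r) - expVCGPay ε i v
        = (2 / ε) * Real.log (∑ r, Real.exp (ε / 2 * ∑ j, v j r))
          - (2 / ε) * Real.log (∑ r, Real.exp (ε / 2 * ∑ j ∈ Finset.univ.erase i, v j r)))
    ∧ 0 ≤ (∑ r, expMech ε v r * v i r) - expVCGPay ε i v
    ∧ (v i = (fun _ => 0) → (∑ r, expMech ε v r * v i r) - expVCGPay ε i v = 0) := by
  have hutil := expVCG_utility_eq hε.ne' v i
  refine ⟨hutil, ?_, fun hzero => ?_⟩
  · rw [hutil, ← mul_sub]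
    refine mul_nonneg (by positivity) (sub_nonneg.2 (Real.log_le_log (by positivity) ?_))
    refine Finset.sum_le_sum fun r _ => Real.exp_le_exp.2 ?_
    exact mul_le_mul_of_nonneg_left (Finset.sum_le_sum_of_subset_of_nonneg
      (Finset.erase_subset _ _) fun j _ _ => (hv j r).1) (by positivity)
  · have herase (r : Alt) : ∑ j ∈ Finset.univ.erase i, v j r = ∑ j, v j r :=
      Finset.sum_erase _ (congrFun hzero r)
    simp only [hutil, herase, sub_self]
end

section
/- Suppose all agents submit their true rational valuation functions at every time step, so that after each history h_{t−1} the joint action taken is ā*_t = f(v̄_t), and let percept sequences be generated by the environment φ under these actions. Then for each agent i, writing m = m_i for its horizon, the quantity v̄_{1,i}(ε) = q̄_{1,i}(ε) − c̄_{1,i}(ε) at the empty history ε equals the expected cumulative reward minus the expected cumulative payment: v̄_{1,i}(ε) = E_{ōr_{1:m}}[ Σ_{t=1}^{m} r_{t,i} ] − E_{ōr_{1:(m−1)}}[ Σ_{t=1}^{m} p_i(v̄_t) ], where the expectations are over percepts drawn from φ along the socially chosen action sequence. -/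
/-!
Multi-agent general reinforcement learning controlled by a VCG mechanism (§4.1 of the
paper).  There are `k` agents, a finite nonempty set `A` of joint actions, and a finite
set `P` of joint percepts; `rew p i` is the reward of agent `i` in joint percept `p`.
Joint histories are lists of (joint action, joint percept) pairs.  The environment
`φ h a p` gives the probability of percept `p` after history `h` and joint action `a`.
Agent `i` has horizon `m i`.  The function `fch t h` is the social choice (joint action)
used by the mechanism at time `t` after history `h`; in the theorems it is assumed to
maximise the reported social welfare.
-/

section Protocol

variable {k : ℕ} {A P : Type*} [Fintype A] [Nonempty A] [Fintype P]

/-- The pair `(q_{t,i}(h, a), c_{t,i}(h, a))` of the rational q-function and the rational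
social cost function, defined by mutual backward recursion (everything is `0` beyond the
largest horizon). -/
noncomputable def QC (φ : List (A × P) → A → P → ℝ) (rew : P → Fin k → ℝ)
    (m : Fin k → ℕ) (fch : ℕ → List (A × P) → A) (t : ℕ) :
    List (A × P) → Fin k → A → ℝ × ℝ :=
  if ht : Finset.univ.sup m < t then fun _ _ _ => (0, 0)
  else fun h i a =>
    let nxt := QC φ rew m fch (t + 1)
    let vnext : List (A × P) → Fin k → A → ℝ :=
      fun h' j b => (nxt h' j b).1 - (nxt h' j b).2
    ⟨if m i < t then 0
      else ∑ p : P, φ h a p *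
        (rew p i + (nxt (h ++ [(a, p)]) i (fch (t + 1) (h ++ [(a, p)]))).1),
     if m i ≤ t then 0
      else ∑ p : P, φ h a p *
        ((Finset.univ.sup' Finset.univ_nonempty
            (fun b => ∑ j ∈ Finset.univ.erase i, vnext (h ++ [(a, p)]) j b)
          - ∑ j ∈ Finset.univ.erase i, vnext (h ++ [(a, p)]) j (fch (t + 1) (h ++ [(a, p)])))
         + (nxt (h ++ [(a, p)]) i (fch (t + 1) (h ++ [(a, p)]))).2)⟩
termination_by Finset.univ.sup m + 1 - t
decreasing_by omega

variable (φ : List (A × P) → A → P → ℝ) (rew : P → Fin k → ℝ)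
  (m : Fin k → ℕ) (fch : ℕ → List (A × P) → A)

/-- The rational q-function `q_{t,i}(h, a)`. -/
noncomputable def qf (t : ℕ) (h : List (A × P)) (i : Fin k) (a : A) : ℝ :=
  (QC φ rew m fch t h i a).1

/-- The rational social cost function `c_{t,i}(h, a)`. -/
noncomputable def cf (t : ℕ) (h : List (A × P)) (i : Fin k) (a : A) : ℝ :=
  (QC φ rew m fch t h i a).2

/-- The rational valuation function `v_{t,i} = q_{t,i} − c_{t,i}`. -/
noncomputable def vf (t : ℕ) (h : List (A × P)) (i : Fin k) (a : A) : ℝ :=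
  qf φ rew m fch t h i a - cf φ rew m fch t h i a

/-- The Clark pivot payment `p_i(v̄_t)` under truthful submission. -/
noncomputable def payf (t : ℕ) (h : List (A × P)) (i : Fin k) : ℝ :=
  Finset.univ.sup' Finset.univ_nonempty
    (fun b => ∑ j ∈ Finset.univ.erase i, vf φ rew m fch t h j b)
  - ∑ j ∈ Finset.univ.erase i, vf φ rew m fch t h j (fch t h)

/-- `q̄_{t,i}(h) = q_{t,i}(h, f(v̄_t))`. -/
noncomputable def qbar (t : ℕ) (h : List (A × P)) (i : Fin k) : ℝ :=
  qf φ rew m fch t h i (fch t h)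

/-- `c̄_{t,i}(h) = p_i(v̄_t) + c_{t,i}(h, f(v̄_t))`. -/
noncomputable def cbar (t : ℕ) (h : List (A × P)) (i : Fin k) : ℝ :=
  payf φ rew m fch t h i + cf φ rew m fch t h i (fch t h)

/-- `v̄_{t,i}(h) = q̄_{t,i}(h) − c̄_{t,i}(h)`. -/
noncomputable def vbar (t : ℕ) (h : List (A × P)) (i : Fin k) : ℝ :=
  qbar φ rew m fch t h i - cbar φ rew m fch t h i

/-- Expected realisable cumulative utility of agent `i` at time `t` after history `h`,
when the joint action `asub` is chosen and the payment `pay` is charged to `i`: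
`E_{ōr_t}[ r_{t,i} − pay + q̄_{t+1,i}(h asub ōr_t) − c̄_{t+1,i}(h asub ōr_t) ]`. -/
noncomputable def expRealUtil (t : ℕ) (h : List (A × P)) (i : Fin k)
    (asub : A) (pay : ℝ) : ℝ :=
  ∑ p : P, φ h asub p *
    (rew p i - pay + qbar φ rew m fch (t + 1) (h ++ [(asub, p)]) i
      - cbar φ rew m fch (t + 1) (h ++ [(asub, p)]) i)

end Protocol

section Rollout

variable {k : ℕ} {A P : Type*} [Fintype A] [Nonempty A] [Fintype P]

/-- Probability, under the environment `φ`, of observing the percept sequence `ps`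
starting from history `h` at time `t` when the socially chosen joint actions `fch` are
taken at every step. -/
noncomputable def rollProb (φ : List (A × P) → A → P → ℝ)
    (fch : ℕ → List (A × P) → A) : ℕ → List (A × P) → List P → ℝ
  | _, _, [] => 1
  | t, h, p :: ps => φ h (fch t h) p * rollProb φ fch (t + 1) (h ++ [(fch t h, p)]) ps

/-- Cumulative reward of agent `i` along the percept sequence `ps` (one reward per
percept), starting from history `h` at time `t`, under the socially chosen actions. -/
noncomputable def cumRew (rew : P → Fin k → ℝ) (fch : ℕ → List (A × P) → A)
    (i : Fin k) : ℕ → List (A × P) → List P → ℝ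
  | _, _, [] => 0
  | t, h, p :: ps => rew p i + cumRew rew fch i (t + 1) (h ++ [(fch t h, p)]) ps

/-- Cumulative Clark pivot payment of agent `i` along the percept sequence `ps`
(one payment per visited history, including the final one), starting from history `h`
at time `t`, under truthful submissions and the socially chosen actions. -/
noncomputable def cumPay (φ : List (A × P) → A → P → ℝ) (rew : P → Fin k → ℝ)
    (m : Fin k → ℕ) (fch : ℕ → List (A × P) → A)
    (i : Fin k) : ℕ → List (A × P) → List P → ℝ
  | t, h, [] => payf φ rew m fch t h i
  | t, h, p :: ps => payf φ rew m fch t h i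
      + cumPay φ rew m fch i (t + 1) (h ++ [(fch t h, p)]) ps

omit [Fintype A] [Nonempty A] in
/-- The sum over percept sequences of length `n + 1` splits off the first percept. -/
theorem sum_rollProb_mul_succ (φ : List (A × P) → A → P → ℝ)
    (fch : ℕ → List (A × P) → A) (n t : ℕ) (h : List (A × P)) (g : List P → ℝ) :
    ∑ ps : Fin (n + 1) → P, rollProb φ fch t h (List.ofFn ps) * g (List.ofFn ps)
      = ∑ p : P, φ h (fch t h) p * ∑ ps : Fin n → P,
          rollProb φ fch (t + 1) (h ++ [(fch t h, p)]) (List.ofFn ps)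
            * g (p :: List.ofFn ps) := by
  rw [← (Fin.consEquiv fun _ : Fin (n + 1) => P).sum_comp, Fintype.sum_prod_type]
  refine Finset.sum_congr rfl fun p _ => ?_
  rw [Finset.mul_sum]
  refine Finset.sum_congr rfl fun ps _ => ?_
  simp [Fin.consEquiv, List.ofFn_succ, rollProb, mul_assoc]

omit [Fintype A] [Nonempty A] in
/-- The rollout probabilities of percept sequences of a fixed length sum to one. -/
theorem sum_rollProb (φ : List (A × P) → A → P → ℝ) (fch : ℕ → List (A × P) → A)
    (hφ1 : ∀ (h : List (A × P)) (a : A), ∑ p : P, φ h a p = 1)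
    (n t : ℕ) (h : List (A × P)) :
    ∑ ps : Fin n → P, rollProb φ fch t h (List.ofFn ps) = 1 := by
  induction n generalizing t h with
  | zero => simp [rollProb]
  | succ n ih =>
    have key := sum_rollProb_mul_succ φ fch n t h fun _ => 1
    simp only [mul_one, ih, hφ1] at key
    exact key

/-- The rational q-function vanishes beyond the horizon. -/
theorem qf_of_lt (φ : List (A × P) → A → P → ℝ) (rew : P → Fin k → ℝ)
    (m : Fin k → ℕ) (fch : ℕ → List (A × P) → A) {t : ℕ} {i : Fin k} (ht : m i < t)
    (h : List (A × P)) (a : A) : qf φ rew m fch t h i a = 0 := by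
  rw [qf, QC]
  split_ifs <;> simp [ht]

/-- The backward recursion of the rational q-function. -/
theorem qf_of_le (φ : List (A × P) → A → P → ℝ) (rew : P → Fin k → ℝ)
    (m : Fin k → ℕ) (fch : ℕ → List (A × P) → A) {t : ℕ} {i : Fin k} (ht : t ≤ m i)
    (h : List (A × P)) (a : A) :
    qf φ rew m fch t h i a
      = ∑ p : P, φ h a p * (rew p i + qbar φ rew m fch (t + 1) (h ++ [(a, p)]) i) := by
  have hsup : ¬ Finset.univ.sup m < t :=
    not_lt.mpr (ht.trans (Finset.le_sup (Finset.mem_univ i)))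
  rw [qf, QC, dif_neg hsup]
  simp only [if_neg ht.not_gt, qbar, qf]

/-- The rational social cost function vanishes from the horizon on. -/
theorem cf_of_le (φ : List (A × P) → A → P → ℝ) (rew : P → Fin k → ℝ)
    (m : Fin k → ℕ) (fch : ℕ → List (A × P) → A) {t : ℕ} {i : Fin k} (ht : m i ≤ t)
    (h : List (A × P)) (a : A) : cf φ rew m fch t h i a = 0 := by
  rw [cf, QC]
  split_ifs <;> simp [ht]

/-- The backward recursion of the rational social cost function. -/
theorem cf_of_lt (φ : List (A × P) → A → P → ℝ) (rew : P → Fin k → ℝ)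
    (m : Fin k → ℕ) (fch : ℕ → List (A × P) → A) {t : ℕ} {i : Fin k} (ht : t < m i)
    (h : List (A × P)) (a : A) :
    cf φ rew m fch t h i a
      = ∑ p : P, φ h a p * cbar φ rew m fch (t + 1) (h ++ [(a, p)]) i := by
  have hsup : ¬ Finset.univ.sup m < t :=
    not_lt.mpr (ht.le.trans (Finset.le_sup (Finset.mem_univ i)))
  rw [cf, QC, dif_neg hsup]
  simp only [if_neg ht.not_ge, cbar, payf, vf, qf, cf]

/-- `q̄` is the expected cumulative reward over the `n` remaining steps. -/
theorem qbar_eq_sum_rollProb_mul_cumRew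
    (φ : List (A × P) → A → P → ℝ) (rew : P → Fin k → ℝ)
    (m : Fin k → ℕ) (fch : ℕ → List (A × P) → A)
    (hφ1 : ∀ (h : List (A × P)) (a : A), ∑ p : P, φ h a p = 1)
    {n t : ℕ} {i : Fin k} (hn : m i + 1 = t + n) (h : List (A × P)) :
    qbar φ rew m fch t h i
      = ∑ ps : Fin n → P,
          rollProb φ fch t h (List.ofFn ps) * cumRew rew fch i t h (List.ofFn ps) := by
  induction n generalizing t h with
  | zero => simp [qbar, qf_of_lt φ rew m fch (show m i < t by omega), cumRew]
  | succ n ih =>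
    rw [qbar, qf_of_le φ rew m fch (by omega), sum_rollProb_mul_succ]
    refine Finset.sum_congr rfl fun p _ => ?_
    simp only [cumRew, mul_add, Finset.sum_add_distrib, ← Finset.sum_mul,
      sum_rollProb φ fch hφ1, one_mul, ← ih (show m i + 1 = t + 1 + n by omega)]

/-- `c̄` is the expected cumulative payment, determined by the next `n` percepts. -/
theorem cbar_eq_sum_rollProb_mul_cumPay
    (φ : List (A × P) → A → P → ℝ) (rew : P → Fin k → ℝ)
    (m : Fin k → ℕ) (fch : ℕ → List (A × P) → A)
    (hφ1 : ∀ (h : List (A × P)) (a : A), ∑ p : P, φ h a p = 1)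
    {n t : ℕ} {i : Fin k} (hn : m i = t + n) (h : List (A × P)) :
    cbar φ rew m fch t h i
      = ∑ ps : Fin n → P,
          rollProb φ fch t h (List.ofFn ps)
            * cumPay φ rew m fch i t h (List.ofFn ps) := by
  induction n generalizing t h with
  | zero => simp [cbar, cf_of_le φ rew m fch (show m i ≤ t by omega), rollProb, cumPay]
  | succ n ih =>
    rw [cbar, cf_of_lt φ rew m fch (by omega), sum_rollProb_mul_succ]
    simp only [cumPay, mul_add, Finset.sum_add_distrib, ← Finset.sum_mul,
      sum_rollProb φ fch hφ1, hφ1, one_mul, ← ih (show m i = t + 1 + n by omega)]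

/-- under truthful submission of the rational valuation functions at every
time step (so the joint action after history `h` at time `t` is `ā*_t = f(v̄_t) = fch t h`),
the quantity `v̄_{1,i}(ε) = q̄_{1,i}(ε) − c̄_{1,i}(ε)` at the empty history equals the
expected cumulative reward over times `1..m` minus the expected cumulative payment over
times `1..m` (payments depending only on the first `m − 1` percepts), where `m = m i`. -/
theorem vbar_eq_expected_reward_sub_expected_payment
    (φ : List (A × P) → A → P → ℝ) (rew : P → Fin k → ℝ)
    (m : Fin k → ℕ) (fch : ℕ → List (A × P) → A)
    (hφ0 : ∀ h a p, 0 ≤ φ h a p)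
    (hφ1 : ∀ (h : List (A × P)) (a : A), ∑ p : P, φ h a p = 1)
    -- `fch t h` maximises the (truthful) reported social welfare
    (hfch : ∀ (t : ℕ) (h : List (A × P)) (a : A),
      ∑ j, vf φ rew m fch t h j a ≤ ∑ j, vf φ rew m fch t h j (fch t h))
    (i : Fin k) (hmi : 1 ≤ m i) :
    vbar φ rew m fch 1 [] i
      = (∑ ps : Fin (m i) → P,
          rollProb φ fch 1 [] (List.ofFn ps) * cumRew rew fch i 1 [] (List.ofFn ps))
        - (∑ ps : Fin (m i - 1) → P,
            rollProb φ fch 1 [] (List.ofFn ps)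
              * cumPay φ rew m fch i 1 [] (List.ofFn ps)) := by
  rw [vbar, qbar_eq_sum_rollProb_mul_cumRew φ rew m fch hφ1 (Nat.add_comm _ _),
    cbar_eq_sum_rollProb_mul_cumPay φ rew m fch hφ1 (Nat.add_sub_of_le hmi).symm]

end Rollout
end

section
/- If the loss function ℓ is η-exp-concave, then for every expert i and every time horizon T, the Hedge algorithm with prior ν and learning rate η has regret bound L_T − L_{T,i} ≤ (1/η) · log(1/ν_i), where L_T = Σ_{t=1}^{T} ℓ(x_t, y_t) is the cumulative loss of Hedge and L_{T,i} = Σ_{t=1}^{T} ℓ(x_{t,i}, y_t) is the cumulative loss of expert i. -/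
/-- Jensen's inequality for an `η`-exp-concave function `f`: multiplying each weight by
`exp (-η f)` shrinks the total weight by at most the factor attained at the weighted mean. -/
theorem sum_mul_exp_le_of_concaveOn_exp {ι E : Type*} [Fintype ι] [AddCommGroup E] [Module ℝ E]
    {X : Set E} {f : E → ℝ} {η : ℝ} (hf : ConcaveOn ℝ X (fun x => Real.exp (-η * f x)))
    {w : ι → ℝ} (hw : ∀ i, 0 ≤ w i) (hw_pos : 0 < ∑ i, w i)
    {x : ι → E} (hx : ∀ i, x i ∈ X) :
    ∑ i, w i * Real.exp (-η * f (x i)) ≤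
      (∑ i, w i) * Real.exp (-η * f ((∑ i, w i)⁻¹ • ∑ i, w i • x i)) := by
  have h := hf.le_map_centerMass (t := Finset.univ) (fun i _ => hw i) hw_pos (fun i _ => hx i)
  simp only [Finset.centerMass, smul_eq_mul] at h
  rwa [inv_mul_le_iff₀ hw_pos] at h


/-- If the loss function ℓ is η-exp-concave, then for every expert i and
every horizon T, Hedge with prior ν and learning rate η satisfies
L_T − L_{T,i} ≤ (1/η) log(1/ν_i). -/
theorem hedge_regret_bound
    {M : Type*} [Fintype M] [Nonempty M]
    {E : Type*} [AddCommGroup E] [Module ℝ E]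
    (X : Set E) (hX : Convex ℝ X)
    {Y : Type*} (ℓ : E → Y → ℝ)
    (η : ℝ) (hη : 0 < η)
    -- η-exp-concavity: x ↦ exp(−η ℓ(x, y)) is concave on X
    (hconc : ∀ y : Y, ConcaveOn ℝ X (fun x => Real.exp (-η * ℓ x y)))
    (ν : M → ℝ) (hν : ∀ i, 0 < ν i) (hν1 : ∑ i, ν i = 1)
    -- expert predictions and outcomes
    (x : ℕ → M → E) (hx : ∀ t i, x t i ∈ X)
    (y : ℕ → Y)
    -- cumulative losses of the experts
    (L : ℕ → M → ℝ)
    (hL : ∀ t i, L t i = ∑ s ∈ Finset.range t, ℓ (x s i) (y s))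
    -- Hedge weights and predictions
    (w : ℕ → M → ℝ) (hw : ∀ t i, w t i = ν i * Real.exp (-η * L t i))
    (xh : ℕ → E)
    (hxh : ∀ t, xh t = (∑ i, w t i)⁻¹ • ∑ i, w t i • x t i)
    (T : ℕ) (i : M) :
    (∑ t ∈ Finset.range T, ℓ (xh t) (y t)) - L T i ≤ (1 / η) * Real.log (1 / ν i) := by
  have hw_pos : ∀ t j, 0 < w t j := fun t j => by
    rw [hw]
    exact mul_pos (hν j) (Real.exp_pos _)
  have hW_pos : ∀ t, 0 < ∑ j, w t j := fun t =>
    Finset.sum_pos (fun j _ => hw_pos t j) Finset.univ_nonempty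
  have hw_succ : ∀ t j, w (t + 1) j = w t j * Real.exp (-η * ℓ (x t j) (y t)) := fun t j => by
    rw [hw, hw, hL, hL, Finset.sum_range_succ, mul_add, Real.exp_add, mul_assoc]
  have hW_le : ∀ t, ∑ j, w t j ≤ Real.exp (-η * ∑ s ∈ Finset.range t, ℓ (xh s) (y s)) := by
    intro t
    induction t with
    | zero => simp [hw, hL, hν1]
    | succ t ih =>
      calc ∑ j, w (t + 1) j = ∑ j, w t j * Real.exp (-η * ℓ (x t j) (y t)) := by
            simp only [hw_succ]
        _ ≤ (∑ j, w t j) * Real.exp (-η * ℓ (xh t) (y t)) := by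
            rw [hxh]
            exact sum_mul_exp_le_of_concaveOn_exp (hconc (y t)) (fun j => (hw_pos t j).le)
              (hW_pos t) (hx t)
        _ ≤ Real.exp (-η * ∑ s ∈ Finset.range t, ℓ (xh s) (y s)) *
              Real.exp (-η * ℓ (xh t) (y t)) := by gcongr
        _ = Real.exp (-η * ∑ s ∈ Finset.range (t + 1), ℓ (xh s) (y s)) := by
            rw [← Real.exp_add, ← mul_add, Finset.sum_range_succ]
  have h_single : ν i * Real.exp (-η * L T i) ≤
      Real.exp (-η * ∑ s ∈ Finset.range T, ℓ (xh s) (y s)) := by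
    rw [← hw]
    exact (Finset.single_le_sum (fun j _ => (hw_pos T j).le) (Finset.mem_univ i)).trans (hW_le T)
  have h_log := Real.log_le_log (mul_pos (hν i) (Real.exp_pos _)) h_single
  rw [Real.log_mul (hν i).ne' (Real.exp_pos _).ne', Real.log_exp, Real.log_exp] at h_log
  rw [one_div, one_div, Real.log_inv, le_inv_mul_iff₀ hη]
  linarith
end

section
/- An interaction protocol satisfies the Guaranteed Utility Property if and only if Σ_{i} max_{s_i ∈ S_i} min_{s_{−i}} U^i(s_i, s_{−i}) = max_{s ∈ Π_j S_j} Σ_{i} U^i(s); that is, the sum over agents of each agent's maximin expected utility equals the maximum achievable total expected utility. -/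
/-- There is a profile of maximin strategies. -/
theorem exists_maximin_profile
    {I : Type*} [Fintype I] [DecidableEq I]
    (S : I → Type*) [∀ i, Fintype (S i)] [∀ i, Nonempty (S i)]
    (U : I → (∀ j, S j) → ℝ) :
    ∃ t : ∀ i, S i, ∀ (i : I) (s : ∀ j, S j),
      Finset.univ.sup' Finset.univ_nonempty (fun si : S i =>
        Finset.univ.inf' Finset.univ_nonempty
          (fun s : ∀ j, S j => U i (Function.update s i si)))
        ≤ U i (Function.update s i (t i)) := by
  choose t _ ht using fun i => Finset.exists_mem_eq_sup' Finset.univ_nonempty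
    (fun si : S i => Finset.univ.inf' Finset.univ_nonempty
      (fun s : ∀ j, S j => U i (Function.update s i si)))
  refine ⟨t, fun i s => (ht i).le.trans ?_⟩
  exact Finset.inf'_le (fun s : ∀ j, S j => U i (Function.update s i (t i))) (Finset.mem_univ s)

/-- An interaction protocol satisfies the Guaranteed Utility Property iff
the sum over agents of each agent's maximin expected utility equals the maximum
achievable total expected utility. -/
theorem gup_iff_sum_maximin_eq_max_total
    {I : Type*} [Fintype I] [Nonempty I] [DecidableEq I]
    (S : I → Type*) [∀ i, Fintype (S i)] [∀ i, Nonempty (S i)]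
    (U : I → (∀ j, S j) → ℝ) :
    -- Guaranteed Utility Property
    (∃ (sstar : ∀ i, S i) (C : I → ℝ),
      (∀ (i : I) (s : ∀ j, S j), C i ≤ U i (Function.update s i (sstar i)))
      ∧ Finset.univ.sup' Finset.univ_nonempty (fun s : ∀ j, S j => ∑ i, U i s) = ∑ i, C i)
    ↔
    (∑ i, Finset.univ.sup' Finset.univ_nonempty (fun si : S i =>
        Finset.univ.inf' Finset.univ_nonempty
          (fun s : ∀ j, S j => U i (Function.update s i si))))
      = Finset.univ.sup' Finset.univ_nonempty (fun s : ∀ j, S j => ∑ i, U i s) := by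
  obtain ⟨t, ht⟩ := exists_maximin_profile S U
  constructor
  · rintro ⟨sstar, C, hC, hmax⟩
    apply le_antisymm
    · refine le_trans (Finset.sum_le_sum fun i _ => ?_)
        (Finset.le_sup' (fun s : ∀ j, S j => ∑ i, U i s) (Finset.mem_univ t))
      simpa using ht i t
    · rw [hmax]
      refine Finset.sum_le_sum fun i _ => ?_
      exact Finset.le_sup'_of_le _ (Finset.mem_univ (sstar i))
        (Finset.le_inf' _ _ fun s _ => hC i s)
  · exact fun h => ⟨t, _, ht, h.symm⟩
end
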